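/- arXiv:1612.09004 — 2 statements merged into one kernel-verified Lean document; each statement's English description precedes it below -/
import Mathlib

section
/- There exist constants M > 0 and h₀ ∈ (0,1) such that for all h ∈ (0,h₀), sup_{(u,v)∈(0,1)²} |∫₋₁¹∫₋₁¹ [C(φ(φ⁻¹(u)−s·h), φ(φ⁻¹(v)−t·h)) − C(u,v)]·k(s)·k(t) ds dt| ≤ M·h². In particular, the smoothing bias of the transformation kernel estimator with ideal (uniform) margins is of order O(h²) uniformly in (u,v). -/
open MeasureTheory Set

noncomputable section

/-- A 2-increasing function with copula margins is 1-Lipschitz in its first argument, so its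
first partial derivative is bounded by one. -/
theorem abs_partialDeriv_le_one_of_copula {C : ℝ → ℝ → ℝ}
    (hground : ∀ u ∈ Icc (0:ℝ) 1, C u 0 = 0) (hmarg : ∀ u ∈ Icc (0:ℝ) 1, C u 1 = u)
    (h2inc : ∀ u₁ u₂ v₁ v₂, u₁ ∈ Icc (0:ℝ) 1 → u₂ ∈ Icc (0:ℝ) 1 →
      v₁ ∈ Icc (0:ℝ) 1 → v₂ ∈ Icc (0:ℝ) 1 → u₁ ≤ u₂ → v₁ ≤ v₂ →
      0 ≤ C u₂ v₂ - C u₂ v₁ - C u₁ v₂ + C u₁ v₁)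
    {u v c : ℝ} (hu : u ∈ Ioo (0:ℝ) 1) (hv : v ∈ Ioo (0:ℝ) 1)
    (hc : HasDerivAt (fun x => C x v) c u) : |c| ≤ 1 := by
  have h0 : (0:ℝ) ∈ Icc (0:ℝ) 1 := by simp
  have h1 : (1:ℝ) ∈ Icc (0:ℝ) 1 := by simp
  have hv' := Ioo_subset_Icc_self hv
  have key : ∀ a ∈ Icc (0:ℝ) 1, ∀ b ∈ Icc (0:ℝ) 1, a ≤ b → |C b v - C a v| ≤ b - a := by
    intro a ha b hb hab
    have lower := h2inc a b 0 v ha hb h0 hv' hab hv.1.le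
    have upper := h2inc a b v 1 ha hb hv' h1 hab hv.2.le
    rw [hground a ha, hground b hb] at lower
    rw [hmarg a ha, hmarg b hb] at upper
    rw [abs_le]
    constructor <;> linarith
  refine hc.le_of_lip' zero_le_one ?_
  filter_upwards [isOpen_Ioo.mem_nhds hu] with x hx
  have hx' := Ioo_subset_Icc_self hx
  have hu' := Ioo_subset_Icc_self hu
  rw [Real.norm_eq_abs, Real.norm_eq_abs, one_mul]
  rcases le_total u x with h | h
  · rw [abs_of_nonneg (sub_nonneg.2 h)]
    exact key u hu' x hx' h
  · rw [abs_sub_comm, abs_sub_comm x, abs_of_nonneg (sub_nonneg.2 h)]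
    exact key x hx' u hu' h

/-- First-order Taylor estimate for a function with bounded second derivative. -/
theorem abs_sub_sub_mul_deriv_le {f f' f'' : ℝ → ℝ} {K : ℝ}
    (hf : ∀ x, HasDerivAt f (f' x) x) (hf' : ∀ x, HasDerivAt f' (f'' x) x)
    (hK : ∀ x, |f'' x| ≤ K) (x y : ℝ) :
    |f y - f x - (y - x) * f' x| ≤ K * (y - x) ^ 2 := by
  have hK0 : 0 ≤ K := (abs_nonneg _).trans (hK 0)
  have lip : ∀ z, |f' z - f' x| ≤ K * |z - x| := fun z =>
    convex_univ.norm_image_sub_le_of_norm_hasDerivWithin_le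
      (fun w _ => (hf' w).hasDerivWithinAt) (fun w _ => hK w) (mem_univ x) (mem_univ z)
  have main := (convex_uIcc x y).norm_image_sub_le_of_norm_hasDerivWithin_le
    (f := fun z => f z - z * f' x) (f' := fun z => f' z - 1 * f' x) (C := K * |y - x|)
    (fun z _ => ((hf z).sub ((hasDerivAt_id z).mul_const _)).hasDerivWithinAt)
    (fun z hz => by
      rw [one_mul]
      exact (lip z).trans
        (mul_le_mul_of_nonneg_left (abs_sub_left_of_mem_uIcc hz) hK0))
    left_mem_uIcc right_mem_uIcc
  rw [Real.norm_eq_abs, Real.norm_eq_abs, mul_assoc, abs_mul_abs_self, ← sq] at main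
  convert main using 2
  ring

/-- First-order Taylor estimate in two variables, from bounds on `F_xx`, `F_xy` and `F_yy`. -/
theorem abs_sub_sub_partialDeriv_le {F Fx Fy Fxx Fxy Fyy : ℝ → ℝ → ℝ} {K : ℝ}
    (hFx : ∀ x y, HasDerivAt (fun z => F z y) (Fx x y) x)
    (hFy : ∀ x y, HasDerivAt (fun z => F x z) (Fy x y) y)
    (hFxx : ∀ x y, HasDerivAt (fun z => Fx z y) (Fxx x y) x)
    (hFxy : ∀ x y, HasDerivAt (fun z => Fx x z) (Fxy x y) y)
    (hFyy : ∀ x y, HasDerivAt (fun z => Fy x z) (Fyy x y) y)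
    (hKxx : ∀ x y, |Fxx x y| ≤ K) (hKxy : ∀ x y, |Fxy x y| ≤ K) (hKyy : ∀ x y, |Fyy x y| ≤ K)
    {h s t : ℝ} (hs : |s| ≤ 1) (ht : |t| ≤ 1) (x y : ℝ) :
    |F (x - s * h) (y - t * h) - F x y + s * h * Fx x y + t * h * Fy x y| ≤ 3 * K * h ^ 2 := by
  have hK0 : 0 ≤ K := (abs_nonneg _).trans (hKxx 0 0)
  have sq_le : ∀ r : ℝ, |r| ≤ 1 → K * (r * h) ^ 2 ≤ K * h ^ 2 := fun r hr => by
    rw [mul_pow]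
    exact mul_le_mul_of_nonneg_left
      (mul_le_of_le_one_left (sq_nonneg h) ((sq_le_one_iff_abs_le_one r).2 hr)) hK0
  have ex := abs_sub_sub_mul_deriv_le (fun z => hFx z (y - t * h))
    (fun z => hFxx z (y - t * h)) (fun z => hKxx z _) x (x - s * h)
  have ey := abs_sub_sub_mul_deriv_le (hFy x) (hFyy x) (hKyy x) y (y - t * h)
  have exy : |Fx x (y - t * h) - Fx x y| ≤ K * |y - t * h - y| :=
    convex_univ.norm_image_sub_le_of_norm_hasDerivWithin_le
      (fun w _ => (hFxy x w).hasDerivWithinAt) (fun w _ => hKxy x w) (mem_univ y) (mem_univ _)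
  have cross : |s * h * (Fx x (y - t * h) - Fx x y)| ≤ K * h ^ 2 := by
    rw [sub_sub_cancel_left, abs_neg, abs_mul] at exy
    rw [abs_mul, abs_mul, ← sq_abs h]
    calc |s| * |h| * |Fx x (y - t * h) - Fx x y|
        ≤ 1 * |h| * (K * (1 * |h|)) := by
          gcongr
          exact exy.trans (by gcongr)
      _ = K * |h| ^ 2 := by ring
  rw [sub_sub_cancel_left, neg_sq] at ex ey
  have ex' := abs_le.1 (ex.trans (sq_le s hs))
  have ey' := abs_le.1 (ey.trans (sq_le t ht))
  have cross' := abs_le.1 cross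
  rw [abs_le]
  constructor <;> linarith [ex'.1, ex'.2, ey'.1, ey'.2, cross'.1, cross'.2]

/-- Integrating a perturbation of an affine function against a bounded kernel with total mass
one and vanishing first moment. -/
theorem abs_integral_mul_kernel_sub_le {k g : ℝ → ℝ} {B K c d : ℝ}
    (hk : IntervalIntegrable k volume (-1) 1) (hB : ∀ s, |k s| ≤ B)
    (hkint : ∫ s in (-1:ℝ)..1, k s = 1) (hkmom1 : ∫ s in (-1:ℝ)..1, s * k s = 0)
    (hg : IntervalIntegrable (fun s => g s * k s) volume (-1) 1)
    (hgK : ∀ s, |s| ≤ 1 → |g s - (d + c * s)| ≤ K) :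
    |(∫ s in (-1:ℝ)..1, g s * k s) - d| ≤ 2 * K * B := by
  have hK0 : 0 ≤ K := (abs_nonneg _).trans (hgK 0 (by simp))
  have hks : IntervalIntegrable (fun s => s * k s) volume (-1) 1 :=
    hk.continuousOn_mul continuousOn_id
  have split : (∫ s in (-1:ℝ)..1, g s * k s) - d
      = ∫ s in (-1:ℝ)..1, (g s - (d + c * s)) * k s := by
    have : ∀ s, (g s - (d + c * s)) * k s = g s * k s - (d * k s + c * (s * k s)) :=
      fun s => by ring
    simp_rw [this]
    rw [intervalIntegral.integral_sub hg ((hk.const_mul d).add (hks.const_mul c)),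
      intervalIntegral.integral_add (hk.const_mul d) (hks.const_mul c),
      intervalIntegral.integral_const_mul, intervalIntegral.integral_const_mul, hkint, hkmom1]
    ring
  rw [split]
  have bound := intervalIntegral.norm_integral_le_of_norm_le_const
    (a := (-1:ℝ)) (b := 1) (C := K * B) (f := fun s => (g s - (d + c * s)) * k s)
    (fun s hs => by
      rw [uIoc_of_le (by norm_num)] at hs
      rw [Real.norm_eq_abs, abs_mul]
      exact mul_le_mul (hgK s (abs_le.2 ⟨hs.1.le, hs.2⟩)) (hB s) (abs_nonneg _) hK0)
  rw [Real.norm_eq_abs, show |(1:ℝ) - -1| = 2 by norm_num] at bound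
  linarith

/-- The product-kernel smoothing bias is bounded by the remainder of an affine approximation. -/
theorem abs_integral_integral_mul_kernel_le {k : ℝ → ℝ} {g : ℝ → ℝ → ℝ} {B K a b : ℝ}
    (hk : IntervalIntegrable k volume (-1) 1) (hB : ∀ s, |k s| ≤ B)
    (hkint : ∫ s in (-1:ℝ)..1, k s = 1) (hkmom1 : ∫ s in (-1:ℝ)..1, s * k s = 0)
    (hg : ∀ s, Continuous (g s))
    (hgK : ∀ s t, |s| ≤ 1 → |t| ≤ 1 → |g s t - (a * s + b * t)| ≤ K) :
    |∫ s in (-1:ℝ)..1, ∫ t in (-1:ℝ)..1, g s t * (k s * k t)| ≤ 4 * K * B ^ 2 := by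
  have hK0 : 0 ≤ K := (abs_nonneg _).trans (hgK 0 0 (by simp) (by simp))
  have hB0 : 0 ≤ B := (abs_nonneg _).trans (hB 0)
  have pull : ∀ s, (∫ t in (-1:ℝ)..1, g s t * (k s * k t))
      = (∫ t in (-1:ℝ)..1, g s t * k t) * k s := fun s => by
    rw [← intervalIntegral.integral_mul_const]
    exact intervalIntegral.integral_congr fun t _ => by ring
  simp_rw [pull]
  have inner : ∀ s, |s| ≤ 1 →
      |(∫ t in (-1:ℝ)..1, g s t * k t) - (0 + a * s)| ≤ 2 * K * B := fun s hs => by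
    rw [zero_add]
    exact abs_integral_mul_kernel_sub_le hk hB hkint hkmom1
      (hk.continuousOn_mul (hg s).continuousOn) (fun t ht => hgK s t hs ht)
  by_cases hint : IntervalIntegrable (fun s => (∫ t in (-1:ℝ)..1, g s t * k t) * k s)
      volume (-1) 1
  · have outer := abs_integral_mul_kernel_sub_le hk hB hkint hkmom1 hint inner
    rw [sub_zero] at outer
    exact outer.trans_eq (by ring)
  · rw [intervalIntegral.integral_undef hint, abs_zero]
    positivity

/-- uniform `O(h²)` bound for the smoothing bias of the transformation
kernel estimator with ideal (uniform) margins. -/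
theorem stmt7
    -- the copula C
    (C : ℝ → ℝ → ℝ)
    (hCground1 : ∀ u ∈ Icc (0:ℝ) 1, C u 0 = 0)
    (hCground2 : ∀ v ∈ Icc (0:ℝ) 1, C 0 v = 0)
    (hCmarg1 : ∀ u ∈ Icc (0:ℝ) 1, C u 1 = u)
    (hCmarg2 : ∀ v ∈ Icc (0:ℝ) 1, C 1 v = v)
    (hC2inc : ∀ u₁ u₂ v₁ v₂, u₁ ∈ Icc (0:ℝ) 1 → u₂ ∈ Icc (0:ℝ) 1 →
      v₁ ∈ Icc (0:ℝ) 1 → v₂ ∈ Icc (0:ℝ) 1 → u₁ ≤ u₂ → v₁ ≤ v₂ →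
      0 ≤ C u₂ v₂ - C u₂ v₁ - C u₁ v₂ + C u₁ v₁)
    -- C is twice continuously differentiable on (0,1)² with bounded second-order partials
    (Cu Cv Cuu Cuv Cvv : ℝ → ℝ → ℝ)
    (hCu : ∀ u ∈ Ioo (0:ℝ) 1, ∀ v ∈ Ioo (0:ℝ) 1, HasDerivAt (fun x => C x v) (Cu u v) u)
    (hCv : ∀ u ∈ Ioo (0:ℝ) 1, ∀ v ∈ Ioo (0:ℝ) 1, HasDerivAt (fun y => C u y) (Cv u v) v)
    (hCuu : ∀ u ∈ Ioo (0:ℝ) 1, ∀ v ∈ Ioo (0:ℝ) 1, HasDerivAt (fun x => Cu x v) (Cuu u v) u)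
    (hCuv : ∀ u ∈ Ioo (0:ℝ) 1, ∀ v ∈ Ioo (0:ℝ) 1, HasDerivAt (fun y => Cu u y) (Cuv u v) v)
    (hCvv : ∀ u ∈ Ioo (0:ℝ) 1, ∀ v ∈ Ioo (0:ℝ) 1, HasDerivAt (fun y => Cv u y) (Cvv u v) v)
    (hCuuCont : ContinuousOn (fun p : ℝ × ℝ => Cuu p.1 p.2) (Ioo 0 1 ×ˢ Ioo 0 1))
    (hCuvCont : ContinuousOn (fun p : ℝ × ℝ => Cuv p.1 p.2) (Ioo 0 1 ×ˢ Ioo 0 1))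
    (hCvvCont : ContinuousOn (fun p : ℝ × ℝ => Cvv p.1 p.2) (Ioo 0 1 ×ˢ Ioo 0 1))
    (hC2bdd : ∃ M : ℝ, ∀ u ∈ Ioo (0:ℝ) 1, ∀ v ∈ Ioo (0:ℝ) 1,
      |Cuu u v| ≤ M ∧ |Cuv u v| ≤ M ∧ |Cvv u v| ≤ M)
    -- φ : increasing bijection of ℝ onto (0,1), twice continuously differentiable,
    -- with bounded first and second derivatives
    (φ φinv φ' φ'' : ℝ → ℝ)
    (hφmono : StrictMono φ) (hφrange : ∀ x, φ x ∈ Ioo (0:ℝ) 1)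
    (hφsurj : ∀ y ∈ Ioo (0:ℝ) 1, ∃ x, φ x = y)
    (hφinv : ∀ x, φinv (φ x) = x)
    (hφdiff : ∀ x, HasDerivAt φ (φ' x) x)
    (hφdiff2 : ∀ x, HasDerivAt φ' (φ'' x) x)
    (hφ''cont : Continuous φ'')
    (hφ'bdd : ∃ M, ∀ x, |φ' x| ≤ M)
    (hφ''bdd : ∃ M, ∀ x, |φ'' x| ≤ M)
    -- the kernel k
    (k : ℝ → ℝ) (hkmeas : Measurable k) (hkbdd : ∃ M, ∀ s, |k s| ≤ M)
    (hksupp : ∀ s, s ∉ Icc (-1:ℝ) 1 → k s = 0)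
    (hksymm : ∀ s, k (-s) = k s)
    (hkint : ∫ s in (-1:ℝ)..1, k s = 1)
    (hkmom1 : ∫ s in (-1:ℝ)..1, s * k s = 0)
    (hkmom2 : ∫ s in (-1:ℝ)..1, s ^ 2 * k s ≠ 0) :
    ∃ M > (0:ℝ), ∃ h₀ ∈ Ioo (0:ℝ) 1, ∀ h ∈ Ioo (0:ℝ) h₀,
      (⨆ u : Ioo (0:ℝ) 1, ⨆ v : Ioo (0:ℝ) 1,
        |∫ s in (-1:ℝ)..1, ∫ t in (-1:ℝ)..1,
          (C (φ (φinv u.1 - s * h)) (φ (φinv v.1 - t * h)) - C u.1 v.1) * (k s * k t)|)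
      ≤ M * h ^ 2 := by
  obtain ⟨M, hM⟩ := hC2bdd
  obtain ⟨P, hP⟩ := hφ'bdd
  obtain ⟨Q, hQ⟩ := hφ''bdd
  obtain ⟨B, hB⟩ := hkbdd
  have hP0 : 0 ≤ P := (abs_nonneg _).trans (hP 0)
  have hQ0 : 0 ≤ Q := (abs_nonneg _).trans (hQ 0)
  have hM0 : 0 ≤ M := (abs_nonneg _).trans (hM _ (hφrange 0) _ (hφrange 0)).1
  have hCu1 : ∀ x y, |Cu (φ x) (φ y)| ≤ 1 := fun x y =>
    abs_partialDeriv_le_one_of_copula hCground1 hCmarg1 hC2inc (hφrange x) (hφrange y)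
      (hCu _ (hφrange x) _ (hφrange y))
  have hCv1 : ∀ x y, |Cv (φ x) (φ y)| ≤ 1 := fun x y =>
    abs_partialDeriv_le_one_of_copula (C := fun v u => C u v) hCground2 hCmarg2
      (fun v₁ v₂ u₁ u₂ hv₁ hv₂ hu₁ hu₂ hv hu => by
        linarith [hC2inc u₁ u₂ v₁ v₂ hu₁ hu₂ hv₁ hv₂ hu hv])
      (hφrange y) (hφrange x) (hCv _ (hφrange x) _ (hφrange y))
  have second_partial_bound : ∀ {c d : ℝ} (x : ℝ), |c| ≤ M → |d| ≤ 1 →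
      |c * φ' x * φ' x + d * φ'' x| ≤ M * P * P + Q := fun {c d} x hc hd => by
    calc |c * φ' x * φ' x + d * φ'' x|
        ≤ |c| * |φ' x| * |φ' x| + |d| * |φ'' x| := by
          rw [← abs_mul, ← abs_mul, ← abs_mul]
          exact abs_add_le _ _
      _ ≤ M * P * P + 1 * Q := by
          gcongr <;> apply_rules
      _ = M * P * P + Q := by rw [one_mul]
  have hk : IntervalIntegrable k volume (-1) 1 :=
    (intervalIntegrable_const (c := B)).mono_fun hkmeas.aestronglyMeasurable
      (Filter.Eventually.of_forall fun s => (hB s).trans (le_abs_self B))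
  have hφinv' : ∀ u ∈ Ioo (0:ℝ) 1, φ (φinv u) = u := fun u hu => by
    obtain ⟨x, rfl⟩ := hφsurj u hu
    rw [hφinv]
  have hFy : ∀ x y, HasDerivAt (fun z => C (φ x) (φ z)) (Cv (φ x) (φ y) * φ' y) y := fun x y =>
    (hCv _ (hφrange x) _ (hφrange y)).comp y (hφdiff y)
  have taylor := fun {h s t : ℝ} (hs : |s| ≤ 1) (ht : |t| ≤ 1) (x y : ℝ) =>
    abs_sub_sub_partialDeriv_le
      (F := fun x y => C (φ x) (φ y))
      (Fx := fun x y => Cu (φ x) (φ y) * φ' x) (Fy := fun x y => Cv (φ x) (φ y) * φ' y)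
      (Fxx := fun x y => Cuu (φ x) (φ y) * φ' x * φ' x + Cu (φ x) (φ y) * φ'' x)
      (Fxy := fun x y => Cuv (φ x) (φ y) * φ' y * φ' x)
      (Fyy := fun x y => Cvv (φ x) (φ y) * φ' y * φ' y + Cv (φ x) (φ y) * φ'' y)
      (K := M * P * P + Q) (h := h)
      (fun x y => (hCu _ (hφrange x) _ (hφrange y)).comp x (hφdiff x))
      hFy
      (fun x y => ((hCuu _ (hφrange x) _ (hφrange y)).comp x (hφdiff x)).mul (hφdiff2 x))
      (fun x y => ((hCuv _ (hφrange x) _ (hφrange y)).comp y (hφdiff y)).mul_const _)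
      (fun x y => ((hCvv _ (hφrange x) _ (hφrange y)).comp y (hφdiff y)).mul (hφdiff2 y))
      (fun x y => second_partial_bound x (hM _ (hφrange x) _ (hφrange y)).1 (hCu1 x y))
      (fun x y => by
        have hcross : |Cuv (φ x) (φ y)| * |φ' y| * |φ' x| ≤ M * P * P := by
          gcongr
          exacts [(hM _ (hφrange x) _ (hφrange y)).2.1, hP y, hP x]
        rw [abs_mul, abs_mul]
        linarith)
      (fun x y => second_partial_bound y (hM _ (hφrange x) _ (hφrange y)).2.2 (hCv1 x y))
      hs ht x y
  refine ⟨4 * (3 * (M * P * P + Q)) * B ^ 2 + 1, by positivity, 1 / 2, by norm_num,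
    fun h _ => ?_⟩
  refine Real.iSup_le (fun u => Real.iSup_le (fun v => ?_) (by positivity)) (by positivity)
  have bias := abs_integral_integral_mul_kernel_le
    (g := fun s t => C (φ (φinv u.1 - s * h)) (φ (φinv v.1 - t * h)) - C u.1 v.1)
    (a := -(h * (Cu u.1 v.1 * φ' (φinv u.1)))) (b := -(h * (Cv u.1 v.1 * φ' (φinv v.1))))
    (K := 3 * (M * P * P + Q) * h ^ 2) hk hB hkint hkmom1
    (fun s => by
      have hcont : Continuous fun z => C (φ (φinv u.1 - s * h)) (φ z) :=
        continuous_iff_continuousAt.2 fun z => (hFy _ z).continuousAt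
      exact (hcont.comp (by fun_prop : Continuous fun t => φinv v.1 - t * h)).sub
        continuous_const)
    (fun s t hs ht => by
      have key := taylor (h := h) hs ht (φinv u.1) (φinv v.1)
      simp only [hφinv' _ u.2, hφinv' _ v.2] at key
      convert key using 2
      ring)
  refine bias.trans ?_
  nlinarith [sq_nonneg h]
end
end

section
/- Let (X,Y) be an ℝ²-valued random vector with joint CDF H and continuous marginal CDFs F, G, and let C be a copula with H(x,y)=C(F(x),G(y)). Then for all a, b ∈ ℝ and every h > 0: E[ K((a − φ⁻¹(F(X)))/h) · K((b − φ⁻¹(G(Y)))/h) ] = ∫₋₁¹∫₋₁¹ C(φ(a − s·h), φ(b − t·h)) · k(s)·k(t) ds dt. -/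
open MeasureTheory Set

noncomputable section

/-- `K(x) = ∫_{-∞}^x k(s) ds`, the kernel distribution function. -/
def Kfun (k : ℝ → ℝ) (x : ℝ) : ℝ := ∫ s in Set.Iic x, k s

namespace CopulaKernel

/-- The Fubini theorem for the mean of a product of two integrals of bounded functions. -/
lemma integral_mul_integral_eq {Ω S T : Type*} [MeasurableSpace Ω] [MeasurableSpace S]
    [MeasurableSpace T] (P : Measure Ω) [IsFiniteMeasure P] (μ : Measure S) [IsFiniteMeasure μ]
    (ν : Measure T) [IsFiniteMeasure ν] {f : Ω → S → ℝ} {g : Ω → T → ℝ}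
    (hf : Measurable (Function.uncurry f)) (hg : Measurable (Function.uncurry g))
    {M N : ℝ} (hfM : ∀ ω s, |f ω s| ≤ M) (hgN : ∀ ω t, |g ω t| ≤ N) :
    ∫ ω, (∫ s, f ω s ∂μ) * (∫ t, g ω t ∂ν) ∂P
      = ∫ s, ∫ t, ∫ ω, f ω s * g ω t ∂P ∂ν ∂μ := by
  have hg' : Measurable fun ω => ∫ t, g ω t ∂ν :=
    (hg.stronglyMeasurable.integral_prod_right (ν := ν)).measurable
  calc ∫ ω, (∫ s, f ω s ∂μ) * (∫ t, g ω t ∂ν) ∂P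
      = ∫ ω, ∫ s, f ω s * (∫ t, g ω t ∂ν) ∂μ ∂P := by
        simp_rw [integral_mul_const]
    _ = ∫ s, ∫ ω, f ω s * (∫ t, g ω t ∂ν) ∂P ∂μ := by
        refine integral_integral_swap (Integrable.of_bound
          (Measurable.aestronglyMeasurable ?_) (M * (N * ν.real univ)) (ae_of_all _ ?_))
        · exact hf.mul (hg'.comp measurable_fst)
        · rintro ⟨ω, s⟩
          have hint : ‖∫ t, g ω t ∂ν‖ ≤ N * ν.real univ :=
            norm_integral_le_of_norm_le_const (ae_of_all _ (hgN ω))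
          simp only [Function.uncurry_apply_pair, norm_mul]
          exact mul_le_mul (hfM ω s) hint (norm_nonneg _) ((abs_nonneg _).trans (hfM ω s))
    _ = ∫ s, ∫ t, ∫ ω, f ω s * g ω t ∂P ∂ν ∂μ := by
        refine integral_congr_ae (ae_of_all _ fun s => ?_)
        simp_rw [← integral_const_mul]
        refine integral_integral_swap (Integrable.of_bound
          (Measurable.aestronglyMeasurable ?_) (M * N) (ae_of_all _ ?_))
        · exact (hf.comp (measurable_fst.prodMk measurable_const)).mul hg
        · rintro ⟨ω, t⟩
          simp only [Function.uncurry_apply_pair, norm_mul]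
          exact mul_le_mul (hfM ω s) (hgN ω t) (norm_nonneg _)
            ((abs_nonneg _).trans (hfM ω s))

/-- A sublevel set of a continuous distribution function at a level in `(0, 1)` is a closed
half-line, at whose endpoint the level is attained. -/
lemma exists_eq_and_forall_le_iff {F : ℝ → ℝ} (hF : Continuous F) (hmono : Monotone F)
    (hbot : Filter.Tendsto F Filter.atBot (nhds 0)) (htop : Filter.Tendsto F Filter.atTop (nhds 1)) {p : ℝ}
    (hp : p ∈ Ioo (0 : ℝ) 1) : ∃ x, F x = p ∧ ∀ z, F z ≤ p ↔ z ≤ x := by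
  obtain ⟨l, hl⟩ := (hbot.eventually (gt_mem_nhds hp.1)).exists
  obtain ⟨r, hr⟩ := (htop.eventually (lt_mem_nhds hp.2)).exists
  obtain ⟨y, hy⟩ := mem_range_of_exists_le_of_exists_ge hF ⟨l, hl.le⟩ ⟨r, hr.le⟩
  have hbdd : BddAbove {z | F z ≤ p} :=
    ⟨r, fun z hz => le_of_not_gt fun hrz => absurd (hmono hrz.le) (not_le.2 (hz.trans_lt hr))⟩
  have hmem : sSup {z | F z ≤ p} ∈ {z | F z ≤ p} :=
    (isClosed_le hF continuous_const).csSup_mem ⟨y, hy.le⟩ hbdd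
  exact ⟨sSup {z | F z ≤ p}, le_antisymm hmem (hy.ge.trans (hmono (le_csSup hbdd hy.le))),
    fun z => ⟨fun hz => le_csSup hbdd hz, fun hz => (hmono hz).trans hmem⟩⟩

section Distribution

variable {Ω : Type*} [MeasurableSpace Ω] {P : Measure Ω} [IsProbabilityMeasure P] {X : Ω → ℝ}
  {F : ℝ → ℝ}

lemma exists_cdf_eq_and_forall_le_iff (hX : Measurable X)
    (hF : ∀ x, F x = (P {ω | X ω ≤ x}).toReal) (hFcont : Continuous F) {p : ℝ}
    (hp : p ∈ Ioo (0 : ℝ) 1) : ∃ x, F x = p ∧ ∀ z, F z ≤ p ↔ z ≤ x := by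
  have : IsProbabilityMeasure (P.map X) := Measure.isProbabilityMeasure_map hX.aemeasurable
  have hcdf : F = ProbabilityTheory.cdf (P.map X) := by
    ext x
    rw [hF, ProbabilityTheory.cdf_eq_real, map_measureReal_apply hX measurableSet_Iic]
    rfl
  refine exists_eq_and_forall_le_iff hFcont ?_ ?_ ?_ hp <;> rw [hcdf]
  exacts [ProbabilityTheory.monotone_cdf _, ProbabilityTheory.tendsto_cdf_atBot _,
    ProbabilityTheory.tendsto_cdf_atTop _]

/-- The probability integral transform of a continuous distribution function. -/
lemma measureReal_cdf_comp_le (hX : Measurable X)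
    (hF : ∀ x, F x = (P {ω | X ω ≤ x}).toReal) (hFcont : Continuous F) {p : ℝ}
    (hp : p ∈ Ioo (0 : ℝ) 1) : P.real {ω | F (X ω) ≤ p} = p := by
  obtain ⟨x, hx, hle⟩ := exists_cdf_eq_and_forall_le_iff hX hF hFcont hp
  simp_rw [hle]
  exact (hF x).symm.trans hx

lemma ae_cdf_comp_mem_Ioo (hX : Measurable X)
    (hF : ∀ x, F x = (P {ω | X ω ≤ x}).toReal) (hFcont : Continuous F) :
    ∀ᵐ ω ∂P, F (X ω) ∈ Ioo (0 : ℝ) 1 := by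
  have hmeas : Measurable fun ω => F (X ω) := hFcont.measurable.comp hX
  have hzero : P.real {ω | F (X ω) ≤ 0} = 0 := by
    refine le_antisymm (le_of_forall_gt_imp_ge_of_dense fun e he => ?_) measureReal_nonneg
    have hp : min e (1 / 2) ∈ Ioo (0 : ℝ) 1 :=
      ⟨by positivity, (min_le_right _ _).trans_lt (by norm_num)⟩
    calc P.real {ω | F (X ω) ≤ 0} ≤ P.real {ω | F (X ω) ≤ min e (1 / 2)} :=
          measureReal_mono fun ω hω => le_trans hω hp.1.le
      _ = min e (1 / 2) := measureReal_cdf_comp_le hX hF hFcont hp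
      _ ≤ e := min_le_left _ _
  have hone : P.real {ω | F (X ω) < 1} = 1 := by
    refine le_antisymm measureReal_le_one (le_of_forall_lt_imp_le_of_dense fun e he => ?_)
    have hp : max e (1 / 2) ∈ Ioo (0 : ℝ) 1 :=
      ⟨lt_max_of_lt_right (by norm_num), max_lt he (by norm_num)⟩
    calc e ≤ max e (1 / 2) := le_max_left _ _
      _ = P.real {ω | F (X ω) ≤ max e (1 / 2)} :=
          (measureReal_cdf_comp_le hX hF hFcont hp).symm
      _ ≤ P.real {ω | F (X ω) < 1} := measureReal_mono fun ω hω => lt_of_le_of_lt hω hp.2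
  have hpos : ∀ᵐ ω ∂P, 0 < F (X ω) := by
    rw [ae_iff]
    simpa only [not_lt] using (measureReal_eq_zero_iff).1 hzero
  have hlt : ∀ᵐ ω ∂P, F (X ω) < 1 := by
    refine (mem_ae_iff_prob_eq_one (measurableSet_lt hmeas measurable_const)).2 ?_
    rw [← ENNReal.toReal_eq_one_iff]
    exact hone
  filter_upwards [hpos, hlt] with ω h₀ h₁ using ⟨h₀, h₁⟩

end Distribution

/-- A kernel distribution function, at a point given through `φ`, as an integral over
`(-1, 1]`. -/
lemma Kfun_eq_integral_indicator {k : ℝ → ℝ} (hksupp : ∀ s, s ∉ Icc (-1 : ℝ) 1 → k s = 0)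
    {φ φinv : ℝ → ℝ} (hφmono : StrictMono φ) (hφsurj : ∀ y ∈ Ioo (0 : ℝ) 1, ∃ x, φ x = y)
    (hφinv : ∀ x, φinv (φ x) = x) (a : ℝ) {h : ℝ} (hh : 0 < h) {u : ℝ}
    (hu : u ∈ Ioo (0 : ℝ) 1) :
    Kfun k ((a - φinv u) / h)
      = ∫ s in Ioc (-1 : ℝ) 1, {s | u ≤ φ (a - s * h)}.indicator k s := by
  obtain ⟨x, rfl⟩ := hφsurj u hu
  have hset : {s | φ x ≤ φ (a - s * h)} = Iic ((a - x) / h) := by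
    ext s
    rw [mem_ofPred_eq, hφmono.le_iff_le, mem_Iic, le_div_iff₀ hh]
    exact le_sub_comm
  rw [hφinv, hset, Kfun, ← integral_Icc_eq_integral_Ioc, ← integral_indicator measurableSet_Iic]
  refine (setIntegral_eq_integral_of_forall_compl_eq_zero fun s hs => ?_).symm
  simp [indicator_apply, hksupp s hs]

lemma measurable_uncurry_indicator_le {Ω : Type*} [MeasurableSpace Ω] {U : Ω → ℝ}
    (hU : Measurable U) {c k : ℝ → ℝ} (hc : Measurable c) (hk : Measurable k) :
    Measurable (Function.uncurry fun ω s => {s | U ω ≤ c s}.indicator k s) :=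
  (hk.comp measurable_snd).indicator
    (measurableSet_le (hU.comp measurable_fst) (hc.comp measurable_snd))

lemma abs_indicator_le {k : ℝ → ℝ} {M : ℝ} (hM : ∀ s, |k s| ≤ M) (A : Set ℝ) (s : ℝ) :
    |A.indicator k s| ≤ M :=
  (norm_indicator_le_norm_self k s).trans (hM s)

lemma ite_mul_ite_eq_ite_and (p q : Prop) [Decidable p] [Decidable q] [Decidable (p ∧ q)]
    (x y : ℝ) :
    (if p then x else 0) * (if q then y else 0) = if p ∧ q then x * y else 0 := by
  by_cases hp : p <;> by_cases hq : q <;> simp [hp, hq]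

end CopulaKernel

/-- representation of the expectation of the product of transformed
kernels in terms of the copula,
`E[K((a−φ⁻¹(F(X)))/h)·K((b−φ⁻¹(G(Y)))/h)] = ∫₋₁¹∫₋₁¹ C(φ(a−sh), φ(b−th)) k(s) k(t) ds dt`. -/
theorem stmt12 {Ω : Type*} [MeasurableSpace Ω]
    (P : Measure Ω) [IsProbabilityMeasure P]
    (X Y : Ω → ℝ) (hX : Measurable X) (hY : Measurable Y)
    (F G : ℝ → ℝ)
    (hF : ∀ x, F x = (P {ω | X ω ≤ x}).toReal)
    (hG : ∀ y, G y = (P {ω | Y ω ≤ y}).toReal)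
    (hFcont : Continuous F) (hGcont : Continuous G)
    -- the copula C : grounded, 2-increasing, with uniform margins
    (C : ℝ → ℝ → ℝ)
    (hCground1 : ∀ u ∈ Icc (0:ℝ) 1, C u 0 = 0)
    (hCground2 : ∀ v ∈ Icc (0:ℝ) 1, C 0 v = 0)
    (hCmarg1 : ∀ u ∈ Icc (0:ℝ) 1, C u 1 = u)
    (hCmarg2 : ∀ v ∈ Icc (0:ℝ) 1, C 1 v = v)
    (hC2inc : ∀ u₁ u₂ v₁ v₂, u₁ ∈ Icc (0:ℝ) 1 → u₂ ∈ Icc (0:ℝ) 1 →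
      v₁ ∈ Icc (0:ℝ) 1 → v₂ ∈ Icc (0:ℝ) 1 → u₁ ≤ u₂ → v₁ ≤ v₂ →
      0 ≤ C u₂ v₂ - C u₂ v₁ - C u₁ v₂ + C u₁ v₁)
    -- Sklar representation H(x,y) = C(F(x), G(y))
    (hSklar : ∀ x y, (P {ω | X ω ≤ x ∧ Y ω ≤ y}).toReal = C (F x) (G y))
    -- the kernel k
    (k : ℝ → ℝ) (hkmeas : Measurable k) (hkbdd : ∃ M, ∀ s, |k s| ≤ M)
    (hksupp : ∀ s, s ∉ Icc (-1:ℝ) 1 → k s = 0)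
    (hksymm : ∀ s, k (-s) = k s)
    (hkint : ∫ s in (-1:ℝ)..1, k s = 1)
    -- φ : continuous increasing bijection of ℝ onto (0,1)
    (φ φinv : ℝ → ℝ)
    (hφcont : Continuous φ) (hφmono : StrictMono φ)
    (hφrange : ∀ x, φ x ∈ Ioo (0:ℝ) 1)
    (hφsurj : ∀ y ∈ Ioo (0:ℝ) 1, ∃ x, φ x = y)
    (hφinv : ∀ x, φinv (φ x) = x)
    (a b : ℝ) (h : ℝ) (hh : 0 < h) :
    ∫ ω, Kfun k ((a - φinv (F (X ω))) / h) * Kfun k ((b - φinv (G (Y ω))) / h) ∂P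
      = ∫ s in (-1:ℝ)..1, ∫ t in (-1:ℝ)..1, C (φ (a - s * h)) (φ (b - t * h)) * (k s * k t) := by
  obtain ⟨M, hM⟩ := hkbdd
  have hFX : Measurable fun ω => F (X ω) := hFcont.measurable.comp hX
  have hGY : Measurable fun ω => G (Y ω) := hGcont.measurable.comp hY
  have hφaff (c : ℝ) : Measurable fun s => φ (c - s * h) :=
    hφcont.measurable.comp (measurable_const.sub (measurable_id.mul_const h))
  have hKK : ∀ᵐ ω ∂P,
      Kfun k ((a - φinv (F (X ω))) / h) * Kfun k ((b - φinv (G (Y ω))) / h)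
        = (∫ s in Ioc (-1 : ℝ) 1, {s | F (X ω) ≤ φ (a - s * h)}.indicator k s)
          * ∫ t in Ioc (-1 : ℝ) 1, {t | G (Y ω) ≤ φ (b - t * h)}.indicator k t := by
    filter_upwards [CopulaKernel.ae_cdf_comp_mem_Ioo hX hF hFcont,
      CopulaKernel.ae_cdf_comp_mem_Ioo hY hG hGcont] with ω hω₁ hω₂
    rw [CopulaKernel.Kfun_eq_integral_indicator hksupp hφmono hφsurj hφinv a hh hω₁,
      CopulaKernel.Kfun_eq_integral_indicator hksupp hφmono hφsurj hφinv b hh hω₂]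
  rw [integral_congr_ae hKK, CopulaKernel.integral_mul_integral_eq P _ _
    (CopulaKernel.measurable_uncurry_indicator_le hFX (hφaff a) hkmeas)
    (CopulaKernel.measurable_uncurry_indicator_le hGY (hφaff b) hkmeas)
    (fun ω s => CopulaKernel.abs_indicator_le hM _ s)
    (fun ω t => CopulaKernel.abs_indicator_le hM _ t)]
  have hneg : (-1 : ℝ) ≤ 1 := by norm_num
  simp_rw [intervalIntegral.integral_of_le hneg]
  refine integral_congr_ae (ae_of_all _ fun s => integral_congr_ae (ae_of_all _ fun t => ?_))
  obtain ⟨x, hx, hxle⟩ :=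
    CopulaKernel.exists_cdf_eq_and_forall_le_iff hX hF hFcont (hφrange (a - s * h))
  obtain ⟨y, hy, hyle⟩ :=
    CopulaKernel.exists_cdf_eq_and_forall_le_iff hY hG hGcont (hφrange (b - t * h))
  have hXY : MeasurableSet {ω | X ω ≤ x ∧ Y ω ≤ y} :=
    (measurableSet_le hX measurable_const).inter (measurableSet_le hY measurable_const)
  calc ∫ ω, {s | F (X ω) ≤ φ (a - s * h)}.indicator k s
        * {t | G (Y ω) ≤ φ (b - t * h)}.indicator k t ∂P
      = ∫ ω, {ω | X ω ≤ x ∧ Y ω ≤ y}.indicator (fun _ => k s * k t) ω ∂P := by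
        refine integral_congr_ae (ae_of_all _ fun ω => ?_)
        simp only [indicator_apply, mem_ofPred_eq, hxle, hyle]
        exact CopulaKernel.ite_mul_ite_eq_ite_and _ _ _ _
    _ = C (φ (a - s * h)) (φ (b - t * h)) * (k s * k t) := by
        rw [integral_indicator_const _ hXY, ← hx, ← hy, ← hSklar, smul_eq_mul]
        rfl
end
end
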